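/- arXiv:2402.00849 — 9 statements merged into one kernel-verified Lean document; each statement's English description precedes it below -/
import Mathlib

section
/- Let n ≥ 1, let ℓ ∈ {1,…,n}, and let B ⊆ {1,…,n}\{ℓ} (the parent set of node ℓ). Let r : ℝ^n → ℝ be strictly positive and continuously differentiable. Let a : ℝ^n → ℝ be strictly positive and continuously differentiable such that: (1) a depends only on the coordinates in B ∪ {ℓ}; (2) for every k ∈ B there exists z ∈ ℝ^n with ∂a/∂z_k(z) ≠ 0; and (3) for every z ∈ ℝ^n, ∫_ℝ a(z with its ℓ-th coordinate replaced by t) dt = 1 (a is a conditional density in the coordinate z_ℓ). Let b : ℝ → ℝ be strictly positive, continuously differentiable, with ∫_ℝ b = 1, and assume there exists z ∈ ℝ^n with a(z) ≠ b(z_ℓ) (the intervention genuinely changes the mechanism of node ℓ). Define p(z) = a(z)·r(z) (observational density) and q(z) = b(z_ℓ)·r(z) (density after a hard intervention on node ℓ). Then for every i ∈ {1,…,n}: there exists z ∈ ℝ^n with ∂_i log p(z) ≠ ∂_i log q(z) if and only if i ∈ B ∪ {ℓ}. -/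
open MeasureTheory

theorem hasDerivAt_comp_update {n : ℕ} {f : (Fin n → ℝ) → ℝ} (hf : Differentiable ℝ f)
    (z : Fin n → ℝ) (i : Fin n) (t : ℝ) :
    HasDerivAt (fun s => f (Function.update z i s))
      (fderiv ℝ f (Function.update z i t) (Pi.single i 1)) t :=
  (hf (Function.update z i t)).hasFDerivAt.comp_hasDerivAt t (hasDerivAt_update z i t)

theorem fderiv_single_eq_zero_of_update_invariant {n : ℕ} {f : (Fin n → ℝ) → ℝ}
    (hf : Differentiable ℝ f) {i : Fin n} (h : ∀ z t, f (Function.update z i t) = f z)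
    (z : Fin n → ℝ) : fderiv ℝ f z (Pi.single i 1) = 0 := by
  have hd := hasDerivAt_comp_update hf z i (z i)
  simp only [h, Function.update_eq_self] at hd
  exact hd.unique (hasDerivAt_const _ _)

theorem update_eq_of_fderiv_single_eq_zero {n : ℕ} {f : (Fin n → ℝ) → ℝ}
    (hf : Differentiable ℝ f) {i : Fin n} (h : ∀ z, fderiv ℝ f z (Pi.single i 1) = 0)
    (z : Fin n → ℝ) (t : ℝ) : f (Function.update z i t) = f z := by
  have hd := fun s => hasDerivAt_comp_update hf z i s
  simp only [h] at hd
  simpa using is_const_of_deriv_eq_zero (fun s => (hd s).differentiableAt)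
    (fun s => (hd s).deriv) t (z i)

/-- If two positive functions have the same score in coordinate `i` and slices in that coordinate
of the same integral `1`, then they are equal. -/
theorem eq_of_score_eq_of_integral_eq_one {n : ℕ} {f g : (Fin n → ℝ) → ℝ} {i : Fin n}
    (hf : Differentiable ℝ f) (hg : Differentiable ℝ g)
    (hf_pos : ∀ z, 0 < f z) (hg_pos : ∀ z, 0 < g z)
    (hf_int : ∀ z, ∫ t : ℝ, f (Function.update z i t) = 1)
    (hg_int : ∀ z, ∫ t : ℝ, g (Function.update z i t) = 1)
    (h : ∀ z, fderiv ℝ (fun w => Real.log (f w)) z (Pi.single i 1)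
      = fderiv ℝ (fun w => Real.log (g w)) z (Pi.single i 1)) (z : Fin n → ℝ) :
    f z = g z := by
  have hlf : Differentiable ℝ fun w => Real.log (f w) := hf.log fun w => (hf_pos w).ne'
  have hlg : Differentiable ℝ fun w => Real.log (g w) := hg.log fun w => (hg_pos w).ne'
  have hconst := update_eq_of_fderiv_single_eq_zero (hlf.sub hlg) (i := i) fun w => by
    rw [fderiv_sub (hlf w) (hlg w), sub_apply, h w, sub_self]
  have hratio : ∀ t, f (Function.update z i t) = f z / g z * g (Function.update z i t) := by
    intro t
    have hlog := hconst z t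
    simp only [Pi.sub_apply] at hlog
    rw [← Real.log_div (hf_pos _).ne' (hg_pos _).ne',
      ← Real.log_div (hf_pos _).ne' (hg_pos _).ne'] at hlog
    rw [← Real.log_injOn_pos (div_pos (hf_pos _) (hg_pos _)) (div_pos (hf_pos _) (hg_pos _)) hlog,
      div_mul_cancel₀ _ (hg_pos _).ne']
  have hint := hf_int z
  simp only [hratio, integral_const_mul, hg_int, mul_one] at hint
  exact (div_eq_one_iff_eq (hg_pos z).ne').mp hint

theorem fderiv_log_mul {n : ℕ} {f g : (Fin n → ℝ) → ℝ}
    (hf : Differentiable ℝ f) (hg : Differentiable ℝ g)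
    (hf_pos : ∀ z, 0 < f z) (hg_pos : ∀ z, 0 < g z) (z : Fin n → ℝ) :
    fderiv ℝ (fun w => Real.log (f w * g w)) z
      = fderiv ℝ (fun w => Real.log (f w)) z + fderiv ℝ (fun w => Real.log (g w)) z := by
  simp only [Real.log_mul (hf_pos _).ne' (hg_pos _).ne']
  exact fderiv_fun_add ((hf z).log (hf_pos z).ne') ((hg z).log (hg_pos z).ne')

/-- Score changes under a hard intervention: with observational density
`p(z) = a(z)·r(z)` (where `a` is the conditional density of node `ℓ` given its
parents `B`) and interventional density `q(z) = b(z_ℓ)·r(z)` (hard intervention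
on node `ℓ`), the scores `∂_i log p` and `∂_i log q` differ somewhere iff
`i ∈ B ∪ {ℓ}`. -/
theorem score_change_hard_intervention
    {n : ℕ} (hn : 1 ≤ n) (ℓ : Fin n) (B : Set (Fin n)) (hB : ℓ ∉ B)
    (r : (Fin n → ℝ) → ℝ) (hr_pos : ∀ z, 0 < r z) (hr_smooth : ContDiff ℝ 1 r)
    (a : (Fin n → ℝ) → ℝ) (ha_pos : ∀ z, 0 < a z) (ha_smooth : ContDiff ℝ 1 a)
    (ha_dep : ∀ z z' : Fin n → ℝ, (∀ i ∈ B ∪ {ℓ}, z i = z' i) → a z = a z')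
    (ha_par : ∀ k ∈ B, ∃ z, fderiv ℝ a z (Pi.single k 1) ≠ 0)
    (ha_cond : ∀ z : Fin n → ℝ, (∫ t : ℝ, a (Function.update z ℓ t)) = 1)
    (b : ℝ → ℝ) (hb_pos : ∀ t, 0 < b t) (hb_smooth : ContDiff ℝ 1 b)
    (hb_int : (∫ t, b t) = 1)
    (hab : ∃ z : Fin n → ℝ, a z ≠ b (z ℓ))
    (p q : (Fin n → ℝ) → ℝ)
    (hp : ∀ z, p z = a z * r z) (hq : ∀ z, q z = b (z ℓ) * r z) :
    ∀ i : Fin n,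
      (∃ z, fderiv ℝ (fun w => Real.log (p w)) z (Pi.single i 1)
          ≠ fderiv ℝ (fun w => Real.log (q w)) z (Pi.single i 1))
        ↔ i ∈ B ∪ {ℓ} := by
  intro i
  have hr := hr_smooth.differentiable one_ne_zero
  have ha := ha_smooth.differentiable one_ne_zero
  have hb : Differentiable ℝ fun w : Fin n → ℝ => b (w ℓ) :=
    (hb_smooth.differentiable one_ne_zero).comp (differentiable_apply ℓ)
  have hb_score : i ≠ ℓ →
      ∀ z, fderiv ℝ (fun w : Fin n → ℝ => Real.log (b (w ℓ))) z (Pi.single i 1) = 0 := fun hi =>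
    fderiv_single_eq_zero_of_update_invariant (hb.log fun w => (hb_pos _).ne') fun z t => by
      rw [Function.update_of_ne hi.symm]
  simp only [hp, hq, fderiv_log_mul ha hr ha_pos hr_pos,
    fderiv_log_mul hb hr (fun w => hb_pos (w ℓ)) hr_pos, add_apply, ne_eq,
    add_left_inj]
  constructor
  · rintro ⟨z, hz⟩
    by_contra hi
    refine hz ?_
    rw [hb_score (fun h => hi (Or.inr h))]
    refine fderiv_single_eq_zero_of_update_invariant (ha.log fun w => (ha_pos w).ne') ?_ z
    intro w t
    rw [ha_dep (Function.update w i t) w fun j hj =>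
      Function.update_of_ne (fun h : j = i => hi (h ▸ hj)) _ _]
  · rintro (hi | rfl)
    · obtain ⟨z, hz⟩ := ha_par i hi
      refine ⟨z, ?_⟩
      rw [hb_score (fun h => hB (h ▸ hi)), fderiv.log (ha z) (ha_pos z).ne']
      simpa using ⟨(ha_pos z).ne', hz⟩
    · by_contra! h
      obtain ⟨z, hz⟩ := hab
      exact hz (eq_of_score_eq_of_integral_eq_one ha hb ha_pos (fun w => hb_pos _) ha_cond
        (by simpa using hb_int) h z)
end

section
/- Let n ≥ 1 and ℓ ∈ {1,…,n}. Let b, b̃ : ℝ → ℝ be strictly positive, continuously differentiable, with ∫_ℝ b = ∫_ℝ b̃ = 1, and b ≠ b̃ (two distinct hard-intervention densities for node ℓ). Let r : ℝ^n → ℝ be strictly positive and continuously differentiable, and define p(z) = b(z_ℓ)·r(z) and p̃(z) = b̃(z_ℓ)·r(z) (the latent densities in two coupled environments in which the same node ℓ is hard intervened). Then for every i ∈ {1,…,n}: there exists z ∈ ℝ^n with ∂_i log p(z) ≠ ∂_i log p̃(z) if and only if i = ℓ. -/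
open MeasureTheory

/-- The directional derivative of `log (c (z ℓ) * r z)` splits into the contributions of the
factors `c` and `r`. -/
theorem fderiv_log_comp_apply_mul {ι : Type*} [Fintype ι] {ℓ : ι} {c : ℝ → ℝ} {r : (ι → ℝ) → ℝ}
    {z : ι → ℝ} (hc : ∀ t, c t ≠ 0) (hr : ∀ z, r z ≠ 0)
    (hcd : DifferentiableAt ℝ c (z ℓ)) (hrd : DifferentiableAt ℝ r z) (v : ι → ℝ) :
    fderiv ℝ (fun w => Real.log (c (w ℓ) * r w)) z v
      = logDeriv c (z ℓ) * v ℓ + fderiv ℝ (fun w => Real.log (r w)) z v := by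
  have hlog : (fun w => Real.log (c (w ℓ) * r w))
      = fun w => Real.log (c (w ℓ)) + Real.log (r w) :=
    funext fun w => Real.log_mul (hc _) (hr _)
  have hcomp : HasFDerivAt (fun w : ι → ℝ => Real.log (c (w ℓ)))
      (logDeriv c (z ℓ) • ContinuousLinearMap.proj (R := ℝ) (φ := fun _ : ι => ℝ) ℓ) z := by
    have hproj : HasFDerivAt (fun w : ι → ℝ => w ℓ)
        (ContinuousLinearMap.proj (R := ℝ) (φ := fun _ : ι => ℝ) ℓ) z := hasFDerivAt_apply ℓ z
    exact HasDerivAt.comp_hasFDerivAt (h₂ := fun t => Real.log (c t)) z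
      (hcd.hasDerivAt.log (hc _)) hproj
  rw [hlog, fderiv_fun_add hcomp.differentiableAt (hrd.log (hr z)), hcomp.fderiv]
  simp

/-- Two nowhere vanishing differentiable functions of total integral one with the same
logarithmic derivative are equal. -/
theorem eq_of_logDeriv_eq_of_integral_eq_one {f g : ℝ → ℝ} (hf : Differentiable ℝ f)
    (hg : Differentiable ℝ g) (hf0 : ∀ t, f t ≠ 0) (hg0 : ∀ t, g t ≠ 0)
    (hfi : ∫ t, f t = 1) (hgi : ∫ t, g t = 1) (h : logDeriv f = logDeriv g) : f = g := by
  obtain ⟨k, -, hk⟩ := (logDeriv_eqOn_iff hf.differentiableOn hg.differentiableOn isOpen_univ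
    isPreconnected_univ (fun t _ => hg0 t) (fun t _ => hf0 t)).1 (fun t _ => congrFun h t)
  have hfg : f = fun t => k * g t := funext fun t => hk (Set.mem_univ t)
  have hk1 : k = 1 := by
    rw [hfg, integral_const_mul, hgi, mul_one] at hfi
    exact hfi
  simpa [hk1] using hfg

/-- Score changes in coupled environments: with `p(z) = b(z_ℓ)·r(z)` and
`p̃(z) = b̃(z_ℓ)·r(z)` the densities of two environments hard-intervening the
same node `ℓ` (with distinct interventional mechanisms `b ≠ b̃`), the scores
`∂_i log p` and `∂_i log p̃` differ somewhere iff `i = ℓ`. -/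
theorem score_change_coupled_environments
    {n : ℕ} (hn : 1 ≤ n) (ℓ : Fin n)
    (b btil : ℝ → ℝ) (hb_pos : ∀ t, 0 < b t) (hbt_pos : ∀ t, 0 < btil t)
    (hb : ContDiff ℝ 1 b) (hbt : ContDiff ℝ 1 btil)
    (hb_int : (∫ t, b t) = 1) (hbt_int : (∫ t, btil t) = 1)
    (hne : b ≠ btil)
    (r : (Fin n → ℝ) → ℝ) (hr_pos : ∀ z, 0 < r z) (hr : ContDiff ℝ 1 r)
    (p ptil : (Fin n → ℝ) → ℝ)
    (hp : ∀ z, p z = b (z ℓ) * r z) (hpt : ∀ z, ptil z = btil (z ℓ) * r z) :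
    ∀ i : Fin n,
      (∃ z, fderiv ℝ (fun v => Real.log (p v)) z (Pi.single i 1)
          ≠ fderiv ℝ (fun v => Real.log (ptil v)) z (Pi.single i 1))
        ↔ i = ℓ := by
  intro i
  obtain rfl : p = fun z => b (z ℓ) * r z := funext hp
  obtain rfl : ptil = fun z => btil (z ℓ) * r z := funext hpt
  have hbd : Differentiable ℝ b := hb.differentiable one_ne_zero
  have hbtd : Differentiable ℝ btil := hbt.differentiable one_ne_zero
  have hrd : Differentiable ℝ r := hr.differentiable one_ne_zero
  have hb0 : ∀ t, b t ≠ 0 := fun t => (hb_pos t).ne'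
  have hbt0 : ∀ t, btil t ≠ 0 := fun t => (hbt_pos t).ne'
  have hr0 : ∀ z, r z ≠ 0 := fun z => (hr_pos z).ne'
  simp only [fderiv_log_comp_apply_mul hb0 hr0 (hbd _) (hrd _),
    fderiv_log_comp_apply_mul hbt0 hr0 (hbtd _) (hrd _), ne_eq, add_left_inj]
  constructor
  · rintro ⟨z, hz⟩
    by_contra hi
    simp [Pi.single_eq_of_ne' hi] at hz
  · rintro rfl
    by_contra! hall
    refine hne (eq_of_logDeriv_eq_of_integral_eq_one hbd hbtd hb0 hbt0 hb_int hbt_int ?_)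
    funext t
    simpa using hall fun _ => t
end

section
/- Let n ≥ 1 and let ℓ ≠ j be indices in {1,…,n}, with sets B_ℓ ⊆ {1,…,n}\{ℓ} and B_j ⊆ {1,…,n}\{j} (the parent sets of ℓ and j) such that ℓ ∉ B_j (without loss of generality ℓ is not a parent of j). Let u, v : ℝ → ℝ be strictly positive, twice continuously differentiable, with ∫_ℝ u = ∫_ℝ v = 1 (noise densities of nodes ℓ and j). Let f, g : ℝ^n → ℝ be continuously differentiable, with f depending only on the coordinates in B_ℓ and ∂f/∂z_k not identically zero for every k ∈ B_ℓ, and g depending only on the coordinates in B_j and ∂g/∂z_k not identically zero for every k ∈ B_j. Let q, q̃ : ℝ → ℝ be strictly positive, continuously differentiable, with ∫_ℝ q = ∫_ℝ q̃ = 1, and assume both interventions genuinely change the model: there exists z with q(z_ℓ) ≠ u(z_ℓ − f(z)), and there exists z with q̃(z_j) ≠ v(z_j − g(z)). Define D : ℝ^n → ℝ by D(z) = log q(z_ℓ) + log v(z_j − g(z)) − log q̃(z_j) − log u(z_ℓ − f(z)) (the difference of the log-densities of an environment hard-intervening node ℓ and an environment hard-intervening node j, in an additive noise model). Then for every i ∈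 {1,…,n}: there exists z ∈ ℝ^n with ∂D/∂z_i(z) ≠ 0 if and only if i ∈ {ℓ, j} ∪ B_ℓ ∪ B_j. -/
open MeasureTheory

/-- A differentiable function on `Fin n → ℝ` has vanishing `i`-th partial derivative iff it does
not depend on the `i`-th coordinate. -/
lemma forall_fderiv_single_eq_zero_iff {n : ℕ} {F : (Fin n → ℝ) → ℝ} (hF : Differentiable ℝ F)
    (i : Fin n) :
    (∀ z, fderiv ℝ F z (Pi.single i 1) = 0) ↔ ∀ z s, F (Function.update z i s) = F z := by
  have key : ∀ z s, HasDerivAt (fun s => F (Function.update z i s))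
      (fderiv ℝ F (Function.update z i s) (Pi.single i 1)) s := fun z s =>
    (hF (Function.update z i s)).hasFDerivAt.comp_hasDerivAt s (hasDerivAt_update z i s)
  constructor
  · intro h z s
    have hconst := is_const_of_deriv_eq_zero (fun s => (key z s).differentiableAt)
      (fun s => (key z s).deriv.trans (h _)) s (z i)
    simpa using hconst
  · intro h z
    have hz := key z (z i)
    simp only [h, Function.update_eq_self] at hz
    exact hz.unique (hasDerivAt_const _ _)

/-- A positive periodic function is not integrable on the line. -/
lemma Function.Periodic.not_integrable_of_pos {u : ℝ → ℝ} {T : ℝ} (hper : Function.Periodic u T)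
    (hT : 0 < T) (hpos : ∀ t, 0 < u t) : ¬ Integrable u := by
  intro hint
  have h1 : Filter.Tendsto (fun t => ∫ x in (0 : ℝ)..t, u x) Filter.atTop Filter.atTop :=
    hper.tendsto_atTop_intervalIntegral_of_pos' hint.intervalIntegrable hpos hT
  exact not_tendsto_nhds_of_tendsto_atTop h1 _
    (intervalIntegral_tendsto_integral_Ioi 0 hint.integrableOn Filter.tendsto_id)

/-- A probability density proportional to a translate of another one equals it. -/
lemma eq_translate_of_log_sub_const {p u : ℝ → ℝ} (hp : ∀ t, 0 < p t) (hu : ∀ t, 0 < u t)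
    (hp_int : (∫ t, p t) = 1) (hu_int : (∫ t, u t) = 1) {a C : ℝ}
    (h : ∀ t, Real.log (p t) - Real.log (u (t - a)) = C) (t : ℝ) : p t = u (t - a) := by
  have hmul : ∀ t, p t = Real.exp C * u (t - a) := fun t => by
    rw [← h t, Real.exp_sub, Real.exp_log (hp t), Real.exp_log (hu _),
      div_mul_cancel₀ _ (hu _).ne']
  have hC : Real.exp C = 1 := by
    have hint : (∫ t, p t) = Real.exp C * ∫ t, u (t - a) := by
      rw [← integral_const_mul]
      exact integral_congr_ae (.of_forall hmul)
    rw [integral_sub_right_eq_self u a, hp_int, hu_int, mul_one] at hint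
    exact hint.symm
  rw [hmul, hC, one_mul]

/-- Two translates of a positive probability density that are proportional to each
other are translates by the same amount. -/
lemma translate_eq_of_log_sub_const {u : ℝ → ℝ} (hu : ∀ t, 0 < u t)
    (hu_int : (∫ t, u t) = 1) {a b C : ℝ}
    (h : ∀ t, Real.log (u (t - a)) - Real.log (u (t - b)) = C) : a = b := by
  have hint : Integrable u := by
    by_contra hn
    rw [integral_undef hn] at hu_int
    exact zero_ne_one hu_int
  have heq := eq_translate_of_log_sub_const (p := fun t => u (t - a)) (fun t => hu _) hu
    ((integral_sub_right_eq_self u a).trans hu_int) hu_int h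
  rcases lt_trichotomy a b with hab | hab | hab
  · refine absurd hint (Function.Periodic.not_integrable_of_pos (T := b - a) (fun t => ?_)
      (sub_pos.2 hab) hu)
    have := heq (t + b)
    rwa [add_sub_cancel_right, add_sub_assoc] at this
  · exact hab
  · refine absurd hint (Function.Periodic.not_integrable_of_pos (T := a - b) (fun t => ?_)
      (sub_pos.2 hab) hu)
    have := heq (t + a)
    rw [add_sub_cancel_right, add_sub_assoc] at this
    exact this.symm

/-- A function depending only on the coordinates in `B` ignores updates outside `B`. -/
lemma apply_update_of_notMem {n : ℕ} {B : Set (Fin n)} {f : (Fin n → ℝ) → ℝ}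
    (hf : ∀ z z' : Fin n → ℝ, (∀ i ∈ B, z i = z' i) → f z = f z') {i : Fin n} (hi : i ∉ B)
    (z : Fin n → ℝ) (s : ℝ) : f (Function.update z i s) = f z :=
  hf _ _ fun _ hk => Function.update_of_ne (ne_of_mem_of_not_mem hk hi) _ _

/-- Score changes in uncoupled environments: for two environments hard-intervening
distinct nodes `ℓ ≠ j` of an additive noise model (with `ℓ` not a parent of `j`),
the difference `D` of the log-densities has a nonvanishing `i`-th partial
derivative somewhere iff `i ∈ {ℓ, j} ∪ B_ℓ ∪ B_j`. -/
theorem score_change_uncoupled_environments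
    {n : ℕ} (hn : 1 ≤ n) (ℓ j : Fin n) (hlj : ℓ ≠ j)
    (Bl Bj : Set (Fin n)) (hBl : ℓ ∉ Bl) (hBj : j ∉ Bj) (hlBj : ℓ ∉ Bj)
    (u v : ℝ → ℝ) (hu_pos : ∀ t, 0 < u t) (hv_pos : ∀ t, 0 < v t)
    (hu : ContDiff ℝ 2 u) (hv : ContDiff ℝ 2 v)
    (hu_int : (∫ t, u t) = 1) (hv_int : (∫ t, v t) = 1)
    (f g : (Fin n → ℝ) → ℝ) (hf : ContDiff ℝ 1 f) (hg : ContDiff ℝ 1 g)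
    (hf_dep : ∀ z z' : Fin n → ℝ, (∀ i ∈ Bl, z i = z' i) → f z = f z')
    (hg_dep : ∀ z z' : Fin n → ℝ, (∀ i ∈ Bj, z i = z' i) → g z = g z')
    (hf_par : ∀ k ∈ Bl, ∃ z, fderiv ℝ f z (Pi.single k 1) ≠ 0)
    (hg_par : ∀ k ∈ Bj, ∃ z, fderiv ℝ g z (Pi.single k 1) ≠ 0)
    (q qtil : ℝ → ℝ) (hq_pos : ∀ t, 0 < q t) (hqt_pos : ∀ t, 0 < qtil t)
    (hq : ContDiff ℝ 1 q) (hqt : ContDiff ℝ 1 qtil)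
    (hq_int : (∫ t, q t) = 1) (hqt_int : (∫ t, qtil t) = 1)
    (hq_ne : ∃ z : Fin n → ℝ, q (z ℓ) ≠ u (z ℓ - f z))
    (hqt_ne : ∃ z : Fin n → ℝ, qtil (z j) ≠ v (z j - g z))
    (D : (Fin n → ℝ) → ℝ)
    (hD : ∀ z, D z = Real.log (q (z ℓ)) + Real.log (v (z j - g z))
        - Real.log (qtil (z j)) - Real.log (u (z ℓ - f z))) :
    ∀ i : Fin n,
      (∃ z, fderiv ℝ D z (Pi.single i 1) ≠ 0)
        ↔ i ∈ ({ℓ, j} : Set (Fin n)) ∪ Bl ∪ Bj := by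
  have hDdiff : Differentiable ℝ D := by
    have hf' := hf.differentiable one_ne_zero
    have hg' := hg.differentiable one_ne_zero
    have hu' := hu.differentiable two_ne_zero
    have hv' := hv.differentiable two_ne_zero
    have hq' := hq.differentiable one_ne_zero
    have hqt' := hqt.differentiable one_ne_zero
    rw [funext hD]
    refine Differentiable.sub (.sub (.add ?_ ?_) ?_) ?_ <;>
      refine Differentiable.log (by fun_prop) fun z => ne_of_gt ?_
    exacts [hq_pos _, hv_pos _, hqt_pos _, hu_pos _]
  have hfl := fun z s => apply_update_of_notMem hf_dep hBl z s
  have hgl := fun z s => apply_update_of_notMem hg_dep hlBj z s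
  have hgj := fun z s => apply_update_of_notMem hg_dep hBj z s
  intro i
  rw [← not_iff_not]
  push Not
  rw [forall_fderiv_single_eq_zero_iff hDdiff]
  constructor
  · intro hind
    have hiBl : i ∉ Bl := by
      intro hi
      have hil : i ≠ ℓ := fun h => hBl (h ▸ hi)
      obtain ⟨z, hz⟩ := hf_par i hi
      refine hz ((forall_fderiv_single_eq_zero_iff (hf.differentiable one_ne_zero) i).2
        (fun z s => ?_) z)
      refine translate_eq_of_log_sub_const hu_pos hu_int
        (C := Real.log (v (Function.update z i s j - g (Function.update z i s)))
          - Real.log (qtil (Function.update z i s j))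
          - (Real.log (v (z j - g z)) - Real.log (qtil (z j)))) fun t => ?_
      have h := hind (Function.update z ℓ t) s
      rw [Function.update_comm hil.symm, hD, hD] at h
      simp only [hfl, hgl, Function.update_self, Function.update_of_ne hlj.symm] at h
      linarith
    have hfi := fun z s => apply_update_of_notMem hf_dep hiBl z s
    have hil : i ≠ ℓ := by
      rintro rfl
      obtain ⟨z, hz⟩ := hq_ne
      refine hz (eq_translate_of_log_sub_const hq_pos hu_pos hq_int hu_int
        (C := Real.log (q (z i)) - Real.log (u (z i - f z))) (fun t => ?_) _)
      have h := hind z t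
      rw [hD, hD] at h
      simp only [hfl, hgl, Function.update_self, Function.update_of_ne hlj.symm] at h
      linarith
    have hij : i ≠ j := by
      rintro rfl
      obtain ⟨z, hz⟩ := hqt_ne
      refine hz (eq_translate_of_log_sub_const hqt_pos hv_pos hqt_int hv_int
        (C := Real.log (qtil (z i)) - Real.log (v (z i - g z))) (fun t => ?_) _)
      have h := hind z t
      rw [hD, hD] at h
      simp only [hfi, hgj, Function.update_self, Function.update_of_ne hlj] at h
      linarith
    have hiBj : i ∉ Bj := by
      intro hi
      obtain ⟨z, hz⟩ := hg_par i hi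
      refine hz ((forall_fderiv_single_eq_zero_iff (hg.differentiable one_ne_zero) i).2
        (fun z s => ?_) z)
      refine translate_eq_of_log_sub_const hv_pos hv_int (C := 0) fun t => ?_
      have h := hind (Function.update z j t) s
      rw [hD, hD, hfi, Function.update_of_ne hil.symm, Function.update_of_ne hij.symm,
        Function.update_comm hij.symm, hgj, hgj, Function.update_self] at h
      linarith
    simp [hil, hij, hiBl, hiBj]
  · intro hi z s
    simp only [Set.mem_union, Set.mem_insert_iff, Set.mem_singleton_iff, not_or] at hi
    obtain ⟨⟨⟨hil, hij⟩, hiBl⟩, hiBj⟩ := hi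
    rw [hD, hD, apply_update_of_notMem hf_dep hiBl, apply_update_of_notMem hg_dep hiBj,
      Function.update_of_ne (Ne.symm hil), Function.update_of_ne (Ne.symm hij)]
end

section
/- Let f : ℝ^s → ℝ^s be a bijective continuously differentiable map whose inverse f⁻¹ is also continuously differentiable, and write J_f(w) for the Jacobian matrix of f at w and J_{f⁻¹}(y) for the Jacobian of f⁻¹ at y. Let p₁, p₂ : ℝ^s → ℝ be strictly positive differentiable functions (the densities of random vectors W₁, W₂), and define q₁, q₂ : ℝ^s → ℝ by q_i(y) = p_i(f⁻¹(y)) · |det J_{f⁻¹}(y)| (the change-of-variables densities of f(W₁), f(W₂)). Then the function y ↦ log q₁(y) − log q₂(y) is differentiable, and for every w ∈ ℝ^s: ∇(log p₁ − log p₂)(w) = J_f(w)ᵀ · ∇(log q₁ − log q₂)(f(w)). That is, the difference of the scores of W₁ and W₂ equals the transposed Jacobian of f applied to the difference of the scores of f(W₁) and f(W₂), the Jacobian-determinant terms cancelling in the difference. -/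
open MeasureTheory Matrix

/-- The matrix of partial derivatives is the matrix of the Fréchet derivative. -/
lemma of_fderiv_apply_single_eq_toMatrix' {m n : ℕ} {f : (Fin m → ℝ) → (Fin n → ℝ)}
    {x : Fin m → ℝ} (hf : DifferentiableAt ℝ f x) :
    (Matrix.of fun i k => fderiv ℝ (fun z => f z i) x (Pi.single k 1)) =
      LinearMap.toMatrix' (fderiv ℝ f x : (Fin m → ℝ) →ₗ[ℝ] (Fin n → ℝ)) := by
  ext i k
  rw [Matrix.of_apply, LinearMap.toMatrix'_apply,
    (hasFDerivAt_pi'.1 hf.hasFDerivAt i).fderiv]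
  simp

/-- The Jacobian determinant of a map with a differentiable left inverse does not vanish. -/
lemma det_of_fderiv_apply_single_ne_zero {n : ℕ} {f g : (Fin n → ℝ) → (Fin n → ℝ)}
    {y : Fin n → ℝ} (hg : DifferentiableAt ℝ g y) (hf : DifferentiableAt ℝ f (g y))
    (hfg : Function.LeftInverse f g) :
    Matrix.det (Matrix.of fun i k => fderiv ℝ (fun x => g x i) y (Pi.single k 1)) ≠ 0 := by
  have hcomp : (fderiv ℝ f (g y)).comp (fderiv ℝ g y) = ContinuousLinearMap.id ℝ _ := by
    rw [← fderiv_comp y hf hg, hfg.comp_eq_id, fderiv_id]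
  rw [of_fderiv_apply_single_eq_toMatrix' hg]
  refine Matrix.det_ne_zero_of_left_inverse
    (B := LinearMap.toMatrix' (fderiv ℝ f (g y) : (Fin n → ℝ) →ₗ[ℝ] (Fin n → ℝ))) ?_
  rw [← LinearMap.toMatrix'_comp, ← ContinuousLinearMap.toLinearMap_comp, hcomp,
    ContinuousLinearMap.coe_id, LinearMap.toMatrix'_id]

/-- The chain rule for the gradient of a scalar function, in coordinates. -/
lemma fderiv_comp_apply_single_eq_transpose_mulVec {m n : ℕ} {f : (Fin m → ℝ) → (Fin n → ℝ)}
    {h : (Fin n → ℝ) → ℝ} {x : Fin m → ℝ}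
    (hh : DifferentiableAt ℝ h (f x)) (hf : DifferentiableAt ℝ f x) :
    (fun i => fderiv ℝ (h ∘ f) x (Pi.single i 1)) =
      (Matrix.of fun i k => fderiv ℝ (fun z => f z i) x (Pi.single k 1))ᵀ.mulVec
        (fun i => fderiv ℝ h (f x) (Pi.single i 1)) := by
  ext k
  rw [fderiv_comp x hh hf, of_fderiv_apply_single_eq_toMatrix' hf,
    ContinuousLinearMap.comp_apply, ← ContinuousLinearMap.coe_coe (fderiv ℝ h (f x)),
    LinearMap.pi_apply_eq_sum_univ]
  have hsingle (i : Fin n) :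
      (fun j => if i = j then (1 : ℝ) else 0) = Pi.single i 1 := by
    ext j
    simp [Pi.single_apply, eq_comm]
  simp [Matrix.mulVec, dotProduct, LinearMap.toMatrix'_apply, hsingle]

/-- Score difference transformation (dimension-preserving case): for a C¹
diffeomorphism `f` of `ℝ^s` with C¹ inverse `g`, strictly positive differentiable
densities `p₁, p₂`, and the change-of-variables densities
`qᵢ(y) = pᵢ(g y)·|det J_g(y)|`, the function `log q₁ − log q₂` is differentiable
and the score difference of `p₁, p₂` at `w` equals the transposed Jacobian of `f`
at `w` applied to the score difference of `q₁, q₂` at `f w`. -/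
theorem score_difference_transformation
    {s : ℕ} (f g : (Fin s → ℝ) → (Fin s → ℝ))
    (hf_bij : Function.Bijective f)
    (hf : ContDiff ℝ 1 f) (hg : ContDiff ℝ 1 g)
    (hgf : ∀ x, g (f x) = x) (hfg : ∀ y, f (g y) = y)
    (p₁ p₂ : (Fin s → ℝ) → ℝ)
    (hp₁_pos : ∀ x, 0 < p₁ x) (hp₂_pos : ∀ x, 0 < p₂ x)
    (hp₁ : Differentiable ℝ p₁) (hp₂ : Differentiable ℝ p₂)
    (q₁ q₂ : (Fin s → ℝ) → ℝ)
    (hq₁ : ∀ y, q₁ y = p₁ (g y) *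
      |Matrix.det (Matrix.of fun i k => fderiv ℝ (fun x => g x i) y (Pi.single k 1))|)
    (hq₂ : ∀ y, q₂ y = p₂ (g y) *
      |Matrix.det (Matrix.of fun i k => fderiv ℝ (fun x => g x i) y (Pi.single k 1))|) :
    Differentiable ℝ (fun y => Real.log (q₁ y) - Real.log (q₂ y)) ∧
    ∀ w : Fin s → ℝ,
      (fun i => fderiv ℝ (fun x => Real.log (p₁ x) - Real.log (p₂ x)) w (Pi.single i 1))
        = (Matrix.of fun i k => fderiv ℝ (fun x => f x i) w (Pi.single k 1))ᵀ.mulVec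
            (fun i => fderiv ℝ (fun y => Real.log (q₁ y) - Real.log (q₂ y)) (f w)
              (Pi.single i 1)) := by
  have hf' : Differentiable ℝ f := hf.differentiable one_ne_zero
  have hg' : Differentiable ℝ g := hg.differentiable one_ne_zero
  have hp : Differentiable ℝ (fun x => Real.log (p₁ x) - Real.log (p₂ x)) :=
    (hp₁.log fun x => (hp₁_pos x).ne').sub (hp₂.log fun x => (hp₂_pos x).ne')
  have hq : (fun y => Real.log (q₁ y) - Real.log (q₂ y)) =
      (fun x => Real.log (p₁ x) - Real.log (p₂ x)) ∘ g := by
    ext y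
    have hdet := abs_ne_zero.2 (det_of_fderiv_apply_single_ne_zero (hg' y) (hf' (g y)) hfg)
    rw [hq₁, hq₂, Real.log_mul (hp₁_pos _).ne' hdet, Real.log_mul (hp₂_pos _).ne' hdet,
      add_sub_add_right_eq_sub, Function.comp_apply]
  have hqd : Differentiable ℝ (fun y => Real.log (q₁ y) - Real.log (q₂ y)) :=
    hq ▸ hp.comp hg'
  refine ⟨hqd, fun w => ?_⟩
  rw [← fderiv_comp_apply_single_eq_transpose_mulVec (hqd (f w)) (hf' w), hq,
    Function.comp_assoc, Function.LeftInverse.comp_eq_id hgf, Function.comp_id]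
end

section
/- Let u, w : ℝ → ℝ be strictly positive real-analytic functions with ∫_ℝ u = ∫_ℝ w = 1, and write r_u = u'/u and r_w = w'/w for their score functions. Let f : ℝ^m → ℝ be continuously differentiable and let k ∈ {1,…,m} be such that ∂f/∂x_k is not identically zero. Then there is no constant c ∈ ℝ such that for all (t, x) ∈ ℝ × ℝ^m: −(∂f/∂x_k)(x) · r_u(t − f(x)) = c · ( r_u(t − f(x)) − r_w(t) ). -/
open MeasureTheory

lemma not_integrable_of_monotone_of_pos {u : ℝ → ℝ} (hpos : ∀ t, 0 < u t) (hu : Monotone u) :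
    ¬ Integrable u := by
  intro hint
  have hconst : IntegrableOn (fun _ : ℝ => u 0) (Set.Ioi 0) := by
    refine Integrable.mono' hint.integrableOn aestronglyMeasurable_const ?_
    filter_upwards [ae_restrict_mem measurableSet_Ioi] with t ht
    rw [Real.norm_of_nonneg (hpos 0).le]
    exact hu (le_of_lt ht)
  rw [integrableOn_const_iff] at hconst
  simp [(hpos 0).ne'] at hconst

lemma not_integrable_of_antitone_of_pos {u : ℝ → ℝ} (hpos : ∀ t, 0 < u t) (hu : Antitone u) :
    ¬ Integrable u := fun hint =>
  not_integrable_of_monotone_of_pos (fun t => hpos (-t)) (fun _ _ h => hu (neg_le_neg h))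
    hint.comp_neg

/-- A function satisfying `r' = a * r` is a multiple of an exponential. -/
lemma eq_mul_exp_of_hasDerivAt {r : ℝ → ℝ} {a : ℝ} (h : ∀ s, HasDerivAt r (a * r s) s) (s : ℝ) :
    r s = r 0 * Real.exp (a * s) := by
  have hd : ∀ s, HasDerivAt (fun s => r s * Real.exp (-(a * s))) 0 s := fun s => by
    have he : HasDerivAt (fun s : ℝ => Real.exp (-(a * s))) (Real.exp (-(a * s)) * -(a * 1)) s :=
      ((hasDerivAt_id s).const_mul a).neg.exp
    exact ((h s).mul he).congr_deriv (by ring)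
  have hc := is_const_of_deriv_eq_zero (fun s => (hd s).differentiableAt) (fun s => (hd s).deriv) s 0
  simp only [mul_zero, neg_zero, Real.exp_zero, mul_one] at hc
  rw [← hc, mul_assoc, ← Real.exp_add]
  simp

/-- A positive function whose score is a multiple of an exponential is monotone or antitone, hence
not integrable. -/
lemma not_integrable_of_score_eq_mul_exp {u : ℝ → ℝ} (hpos : ∀ t, 0 < u t)
    (hd : Differentiable ℝ u) {A a : ℝ} (h : ∀ t, deriv u t / u t = A * Real.exp (a * t)) :
    ¬ Integrable u := by
  have hder : ∀ t, deriv u t = A * (Real.exp (a * t) * u t) := fun t => by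
    rw [← mul_assoc, ← h t, div_mul_cancel₀ _ (hpos t).ne']
  have hfac : ∀ t, 0 ≤ Real.exp (a * t) * u t := fun t =>
    mul_nonneg (Real.exp_pos _).le (hpos t).le
  rcases le_total 0 A with hA | hA
  · refine not_integrable_of_monotone_of_pos hpos (monotone_of_deriv_nonneg hd fun t => ?_)
    rw [hder]
    exact mul_nonneg hA (hfac t)
  · refine not_integrable_of_antitone_of_pos hpos (antitone_of_deriv_nonpos hd fun t => ?_)
    rw [hder]
    exact mul_nonpos_of_nonpos_of_nonneg hA (hfac t)

/-- If the translates of `r` along the values of `f` are all proportional to `q ≠ 0`, and `f` has a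
nonzero directional derivative somewhere, then `r` is a multiple of an exponential. -/
lemma exists_eq_mul_exp_of_eq_mul_translate {E : Type*} [NormedAddCommGroup E] [NormedSpace ℝ E]
    {r q : ℝ → ℝ} (hr : Differentiable ℝ r) {f α : E → ℝ} {x v : E}
    (hf : DifferentiableAt ℝ f x) (hv : fderiv ℝ f x v ≠ 0) {t₀ : ℝ} (hq : q t₀ ≠ 0)
    (h : ∀ t y, q t = α y * r (t - f y)) :
    ∃ A a : ℝ, ∀ s, r s = A * Real.exp (a * s) := by
  have hline : HasDerivAt (fun s : ℝ => f (x + s • v)) (fderiv ℝ f x v) 0 :=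
    hf.hasFDerivAt.hasLineDerivAt v
  have htrans : ∀ t, HasDerivAt (fun s : ℝ => r (t - f (x + s • v)))
      (deriv r (t - f x) * -fderiv ℝ f x v) 0 := fun t => by
    have hr' : HasDerivAt r (deriv r (t - f x)) (t - f (x + (0 : ℝ) • v)) := by
      simpa using (hr (t - f x)).hasDerivAt
    exact hr'.comp (0 : ℝ) (hline.const_sub t)
  have hswap : ∀ t, q t₀ * deriv r (t - f x) = q t * deriv r (t₀ - f x) := fun t => by
    have heq : (fun s : ℝ => q t₀ * r (t - f (x + s • v)))
        = fun s : ℝ => q t * r (t₀ - f (x + s • v)) := by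
      funext s
      rw [h t₀ (x + s • v), h t (x + s • v)]
      ring
    have hL := (htrans t).const_mul (q t₀)
    rw [heq] at hL
    have huniq := hL.unique ((htrans t₀).const_mul (q t))
    refine mul_right_cancel₀ (neg_ne_zero.mpr hv) ?_
    linarith
  refine ⟨r 0, α x * deriv r (t₀ - f x) / q t₀, eq_mul_exp_of_hasDerivAt fun s => ?_⟩
  refine (hr s).hasDerivAt.congr_deriv ?_
  have hs := hswap (s + f x)
  rw [h (s + f x) x, add_sub_cancel_right] at hs
  field_simp
  linarith

/-- Assumption 1 holds for additive noise models under hard interventions: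
with `r_u = u'/u` and `r_w = w'/w` the scores of the noise densities, the
score-difference coordinate `−(∂f/∂x_k)(x)·r_u(t − f(x))` of a parent `k` is
never a constant multiple of the intervened node's coordinate
`r_u(t − f(x)) − r_w(t)` on all of `ℝ × ℝ^m`. -/
theorem assumption_one_additive_hard
    {m : ℕ} (u w : ℝ → ℝ)
    (hu_pos : ∀ t, 0 < u t) (hw_pos : ∀ t, 0 < w t)
    (hu_an : ∀ t, AnalyticAt ℝ u t) (hw_an : ∀ t, AnalyticAt ℝ w t)
    (hu_int : (∫ t, u t) = 1) (hw_int : (∫ t, w t) = 1)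
    (f : (Fin m → ℝ) → ℝ) (hf : ContDiff ℝ 1 f)
    (k : Fin m) (hfk : ∃ x, fderiv ℝ f x (Pi.single k 1) ≠ 0) :
    ¬ ∃ c : ℝ, ∀ t : ℝ, ∀ x : Fin m → ℝ,
      -(fderiv ℝ f x (Pi.single k 1)) * (deriv u (t - f x) / u (t - f x))
        = c * (deriv u (t - f x) / u (t - f x) - deriv w t / w t) := by
  rintro ⟨c, hc⟩
  obtain ⟨x, hx⟩ := hfk
  have hu : Integrable u := Integrable.of_integral_ne_zero (by simp [hu_int])
  have hw : Integrable w := Integrable.of_integral_ne_zero (by simp [hw_int])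
  have hud : Differentiable ℝ u := fun t => (hu_an t).differentiableAt
  have hwd : Differentiable ℝ w := fun t => (hw_an t).differentiableAt
  have hu_not : ¬ ∃ A a : ℝ, ∀ t, deriv u t / u t = A * Real.exp (a * t) :=
    fun ⟨_, _, h⟩ => not_integrable_of_score_eq_mul_exp hu_pos hud h hu
  rcases eq_or_ne c 0 with rfl | hc0
  · refine hu_not ⟨0, 0, fun t => ?_⟩
    have ht := hc (t + f x) x
    rw [add_sub_cancel_right, zero_mul] at ht
    rw [zero_mul]
    exact (mul_eq_zero.mp ht).resolve_left (neg_ne_zero.mpr hx)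
  · obtain ⟨t₀, ht₀⟩ : ∃ t, deriv w t / w t ≠ 0 := by
      by_contra! h0
      exact not_integrable_of_score_eq_mul_exp (A := 0) (a := 0) hw_pos hwd
        (fun t => by rw [h0 t, zero_mul]) hw
    have hscore : Differentiable ℝ fun t => deriv u t / u t := fun t =>
      (hu_an t).deriv.differentiableAt.div (hud t) (hu_pos t).ne'
    refine hu_not (exists_eq_mul_exp_of_eq_mul_translate (q := fun t => deriv w t / w t)
      (α := fun y => 1 + fderiv ℝ f y (Pi.single k 1) / c) hscore
      (hf.differentiable one_ne_zero x) hx ht₀ fun t y => mul_left_cancel₀ hc0 ?_)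
    have hty := hc t y
    have hcancel : c * (fderiv ℝ f y (Pi.single k 1) / c) = fderiv ℝ f y (Pi.single k 1) :=
      mul_div_cancel₀ _ hc0
    linear_combination hty - deriv u (t - f y) / u (t - f y) * hcancel
end

section
/- Let σ'(x) = e^x/(1+e^x)² denote the derivative of the logistic sigmoid. Let W be a w×d real matrix with rank(W) = d whose rows W_1, …, W_w are all nonzero and satisfy W_i ≠ W_j and W_i ≠ −W_j for all i ≠ j, and let ν ∈ ℝ^w have all entries nonzero. Then for every nonzero b ∈ ℝ^d, the function φ ↦ Σ_{i=1}^{w} ν_i · σ'(⟨W_i, φ⟩) · ⟨W_i, b⟩ (that is, φ ↦ σ'(Wφ)ᵀ · diag(ν) · W · b, with σ' applied entrywise) is not constant on ℝ^d. -/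
open Matrix

open Filter Topology

/-- The derivative of the logistic sigmoid, `x ↦ eˣ / (1 + eˣ)²`, is even. -/
theorem exp_div_one_add_exp_sq_abs (x : ℝ) :
    Real.exp |x| / (1 + Real.exp |x|) ^ 2 = Real.exp x / (1 + Real.exp x) ^ 2 := by
  rcases abs_choice x with h | h
  · rw [h]
  · rw [h, Real.exp_neg]
    have := Real.exp_pos x
    field_simp
    ring

/-- For `a > 0` and `m ≤ a`, the function `t ↦ e^{mt} σ'(at)` tends to `1` if `a = m` and to `0`
otherwise. -/
theorem tendsto_exp_mul_exp_div_one_add_exp_sq {a m : ℝ} (ha : 0 < a) (hm : m ≤ a) :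
    Tendsto (fun t : ℝ => Real.exp (m * t) * (Real.exp (a * t) / (1 + Real.exp (a * t)) ^ 2))
      atTop (𝓝 (if a = m then 1 else 0)) := by
  have hdecay {c : ℝ} (hc : 0 < c) : Tendsto (fun t : ℝ => Real.exp (-(c * t))) atTop (𝓝 0) :=
    Real.tendsto_exp_neg_atTop_nhds_zero.comp (tendsto_id.const_mul_atTop hc)
  have hnum : Tendsto (fun t : ℝ => Real.exp (-((a - m) * t))) atTop
      (𝓝 (if a = m then 1 else 0)) := by
    split_ifs with h
    · simp [h]
    · exact hdecay (sub_pos.2 (lt_of_le_of_ne hm (Ne.symm h)))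
  have hden : Tendsto (fun t : ℝ => (1 + Real.exp (-(a * t))) ^ 2) atTop (𝓝 1) := by
    simpa using ((hdecay ha).const_add 1).pow 2
  have hquot := hnum.div hden one_ne_zero
  rw [div_one] at hquot
  refine hquot.congr fun t => ?_
  have hsplit : Real.exp (-((a - m) * t)) = Real.exp (m * t) * (Real.exp (a * t))⁻¹ := by
    rw [← Real.exp_neg, ← Real.exp_add]
    ring_nf
  have := Real.exp_pos (a * t)
  rw [Pi.div_apply, hsplit, Real.exp_neg]
  field_simp
  ring

/-- Dilates of `σ'` by nonzero factors with distinct absolute values are linearly independent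
modulo constants. -/
theorem eq_zero_of_sum_exp_div_one_add_exp_sq_eq_const {ι : Type*} [Fintype ι] {a c : ι → ℝ}
    (ha : ∀ i, a i ≠ 0) (hinj : Function.Injective fun i => |a i|) {C : ℝ}
    (h : ∀ t : ℝ, ∑ i, c i * (Real.exp (a i * t) / (1 + Real.exp (a i * t)) ^ 2) = C) :
    ∀ i, c i = 0 := by
  have hpos (i : ι) : 0 < |a i| := abs_pos.2 (ha i)
  have habs (t : ℝ) (ht : 0 ≤ t) :
      ∑ i, c i * (Real.exp (|a i| * t) / (1 + Real.exp (|a i| * t)) ^ 2) = C := by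
    rw [← h t]
    refine Finset.sum_congr rfl fun i _ => ?_
    rw [← exp_div_one_add_exp_sq_abs (a i * t), abs_mul, abs_of_nonneg ht]
  have hlim (m : ℝ) (hm : ∀ i, c i ≠ 0 → m ≤ |a i|) :
      Tendsto (fun t : ℝ => Real.exp (m * t) * C) atTop
        (𝓝 (∑ i, c i * if |a i| = m then 1 else 0)) := by
    have hsum : Tendsto (fun t : ℝ => ∑ i, c i * (Real.exp (m * t) *
        (Real.exp (|a i| * t) / (1 + Real.exp (|a i| * t)) ^ 2))) atTop
        (𝓝 (∑ i, c i * if |a i| = m then 1 else 0)) := by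
      refine tendsto_finsetSum _ fun i _ => ?_
      by_cases hc : c i = 0
      · simp [hc]
      · exact (tendsto_exp_mul_exp_div_one_add_exp_sq (hpos i) (hm i hc)).const_mul (c i)
    refine hsum.congr' ?_
    filter_upwards [eventually_ge_atTop 0] with t ht
    rw [← habs t ht, Finset.mul_sum]
    exact Finset.sum_congr rfl fun i _ => mul_left_comm _ _ _
  have hC : C = 0 := by
    have h0 := hlim 0 fun i _ => abs_nonneg _
    simp only [zero_mul, Real.exp_zero, one_mul, (hpos _).ne', if_false, mul_zero,
      Finset.sum_const_zero] at h0
    exact tendsto_nhds_unique tendsto_const_nhds h0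
  by_contra! hne
  obtain ⟨i₀, hi₀⟩ := hne
  obtain ⟨j, hj, hmin⟩ := Finset.exists_min_image (Finset.univ.filter fun i => c i ≠ 0)
    (fun i => |a i|) ⟨i₀, by simpa using hi₀⟩
  have hjlim := hlim |a j| fun i hi => hmin i (by simpa using hi)
  have hsum : ∑ i, c i * (if |a i| = |a j| then 1 else 0) = c j := by
    rw [Finset.sum_eq_single j]
    · simp
    · intro i _ hij
      rw [if_neg (hinj.ne hij), mul_zero]
    · simp
  rw [hsum, hC] at hjlim
  simp only [mul_zero] at hjlim
  exact (Finset.mem_filter.1 hj).2 (tendsto_nhds_unique hjlim tendsto_const_nhds)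

/-- Finitely many nonzero vectors, pairwise neither equal nor opposite, have a linear functional
whose values on them are nonzero and have distinct absolute values. -/
theorem exists_dual_ne_zero_and_injective_abs {ι V : Type*} [Finite ι] [AddCommGroup V]
    [Module ℝ V] {v : ι → V} (hv : ∀ i, v i ≠ 0)
    (hpair : ∀ i j, i ≠ j → v i ≠ v j ∧ v i ≠ -v j) :
    ∃ f : Module.Dual ℝ V, (∀ i, f (v i) ≠ 0) ∧ Function.Injective fun i => |f (v i)| := by
  let P := {p : ι × ι // p.1 ≠ p.2}
  obtain ⟨f, hf⟩ := Module.exists_dual_forall_apply_ne_zero (K := ℝ)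
    (Sum.elim v (Sum.elim (fun p : P => v p.1.1 - v p.1.2) fun p : P => v p.1.1 + v p.1.2)) (by
      rintro (i | p | p)
      · exact hv i
      · exact sub_ne_zero.2 (hpair _ _ p.2).1
      · exact fun h => (hpair _ _ p.2).2 (eq_neg_of_add_eq_zero_left h))
  refine ⟨f, fun i => hf (.inl i), fun i j hij => ?_⟩
  by_contra hne
  have hsub := hf (.inr (.inl ⟨(i, j), hne⟩))
  have hadd := hf (.inr (.inr ⟨(i, j), hne⟩))
  simp only [Sum.elim_inr, Sum.elim_inl, map_sub, map_add] at hsub hadd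
  rcases abs_eq_abs.1 hij with h | h
  · exact hsub (sub_eq_zero.2 h)
  · exact hadd (by rw [h, neg_add_cancel])

/-- A matrix of full column rank has trivial kernel. -/
theorem Matrix.eq_zero_of_mulVec_eq_zero_of_rank_eq {K m n : Type*} [Field K] [Fintype m]
    [Fintype n] {A : Matrix m n K} (hA : A.rank = Fintype.card n) {b : n → K}
    (hb : A *ᵥ b = 0) : b = 0 := by
  have hdim := A.mulVecLin.finrank_range_add_finrank_ker
  rw [Module.finrank_fintype_fun_eq_card, ← hA, Matrix.rank, Nat.add_eq_left,
    Submodule.finrank_eq_zero] at hdim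
  have hmem : b ∈ LinearMap.ker A.mulVecLin := hb
  rwa [hdim] at hmem

/-- Two-layer neural networks satisfy the full-rank score-difference condition:
for a full-column-rank weight matrix `W` with nonzero, pairwise non-equal and
non-opposite rows, and nonzero outer weights `ν`, no nonzero direction `b`
makes `φ ↦ Σᵢ νᵢ·σ'(⟨Wᵢ,φ⟩)·⟨Wᵢ,b⟩` constant, where `σ'(x) = eˣ/(1+eˣ)²`. -/
theorem nn_directional_derivative_not_constant
    {w d : ℕ} (W : Matrix (Fin w) (Fin d) ℝ) (hrank : W.rank = d)
    (hrows : ∀ i, W i ≠ 0)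
    (hdistinct : ∀ i j : Fin w, i ≠ j → W i ≠ W j ∧ W i ≠ -W j)
    (ν : Fin w → ℝ) (hν : ∀ i, ν i ≠ 0) :
    ∀ b : Fin d → ℝ, b ≠ 0 →
      ¬ ∃ const : ℝ, ∀ φ : Fin d → ℝ,
        (∑ i, ν i * (Real.exp (∑ k, W i k * φ k) / (1 + Real.exp (∑ k, W i k * φ k)) ^ 2)
            * (∑ k, W i k * b k)) = const := by
  rintro b hb ⟨C, hC⟩
  obtain ⟨f, hf, hinj⟩ := exists_dual_ne_zero_and_injective_abs hrows hdistinct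
  have hrep (i : Fin w) (t : ℝ) :
      ∑ k, W i k * (t * f (Pi.single k 1)) = f (W i) * t := by
    conv_rhs => rw [pi_eq_sum_univ' (W i)]
    simp only [map_sum, map_smul, smul_eq_mul, Finset.sum_mul]
    exact Finset.sum_congr rfl fun k _ => by ring_nf
  have hzero := eq_zero_of_sum_exp_div_one_add_exp_sq_eq_const
    (c := fun i => ν i * ∑ k, W i k * b k) (C := C) hf hinj fun t => by
      rw [← hC fun k => t * f (Pi.single k 1)]
      refine Finset.sum_congr rfl fun i _ => ?_
      rw [hrep]
      ring
  refine hb (Matrix.eq_zero_of_mulVec_eq_zero_of_rank_eq (by simpa using hrank) ?_)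
  funext i
  exact (mul_eq_zero.1 (hzero i)).resolve_left (hν i)
end

section
/- Let n ≥ 1 and let pa be a relation on {1,…,n} (pa(j,i) meaning 'j is a parent of i') such that pa(j,i) implies j < i (the identity order is a valid causal order). Write An(i) for the set of j such that there is a directed path from j to i, i.e. the transitive closure of pa: An(i) = { j : pa⁺(j,i) }. Let L be an n×n real matrix with L_{ii} ≠ 0 for every i and with L_{ij} = 0 whenever i ≠ j and pa(j,i) does not hold (the support of L off the diagonal is contained in the parent pattern). Then L is invertible, (L⁻¹)_{ii} ≠ 0 for every i, and (L⁻¹)_{ij} = 0 whenever i ≠ j and j ∉ An(i) (the support of L⁻¹ off the diagonal is contained in the ancestor pattern). -/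
open Matrix

namespace Matrix

variable {m K : Type*} [Fintype m] [LinearOrder m] [Field K] {pa : m → m → Prop}
  {L : Matrix m m K}

theorem isUnit_det_of_parent_support (hpa : ∀ i j, pa j i → j < i) (hdiag : ∀ i, L i i ≠ 0)
    (hsupp : ∀ i j, i ≠ j → ¬ pa j i → L i j = 0) : IsUnit L.det := by
  have hL : L.IsLowerTriangular := fun i j (hij : i < j) =>
    hsupp i j hij.ne fun h => (hpa i j h).asymm hij
  rw [det_of_isLowerTriangular L hL]
  exact (Finset.prod_ne_zero_iff.mpr fun i _ => hdiag i).isUnit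

theorem inv_apply_eq_zero_of_not_ancestor (hpa : ∀ i j, pa j i → j < i)
    (hdiag : ∀ i, L i i ≠ 0) (hsupp : ∀ i j, i ≠ j → ¬ pa j i → L i j = 0) (i j : m)
    (hij : i ≠ j) (hanc : ¬ Relation.TransGen pa j i) : L⁻¹ i j = 0 := by
  induction i using WellFoundedLT.induction with
  | ind i ih =>
    have hrow : ∑ k, L i k * L⁻¹ k j = 0 := by
      rw [← mul_apply, mul_nonsing_inv L (isUnit_det_of_parent_support hpa hdiag hsupp),
        one_apply_ne hij]
    rw [Fintype.sum_eq_single i] at hrow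
    · exact (mul_eq_zero.mp hrow).resolve_left (hdiag i)
    · intro k hki
      by_cases hk : pa k i
      · have hkj : k ≠ j := by
          rintro rfl
          exact hanc (.single hk)
        rw [ih k (hpa i k hk) hkj fun h => hanc (h.tail hk), mul_zero]
      · rw [hsupp i k hki.symm hk, zero_mul]

theorem inv_apply_self_ne_zero_of_parent_support (hpa : ∀ i j, pa j i → j < i)
    (hdiag : ∀ i, L i i ≠ 0) (hsupp : ∀ i j, i ≠ j → ¬ pa j i → L i j = 0) (i : m) :
    L⁻¹ i i ≠ 0 := by
  have hrow : ∑ k, L i k * L⁻¹ k i = 1 := by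
    rw [← mul_apply, mul_nonsing_inv L (isUnit_det_of_parent_support hpa hdiag hsupp),
      one_apply_eq]
  rw [Fintype.sum_eq_single i] at hrow
  · exact right_ne_zero_of_mul_eq_one hrow
  · intro k hki
    by_cases hk : pa k i
    · have hanc : ¬ Relation.TransGen pa i k := fun h =>
        (hpa i k hk).asymm (Relation.TransGen.trans_induction_on h (hpa _ _ ·)
          fun _ _ => lt_trans)
      rw [inv_apply_eq_zero_of_not_ancestor hpa hdiag hsupp k i hki hanc, mul_zero]
    · rw [hsupp i k hki.symm hk, zero_mul]

end Matrix

/-- A matrix whose off-diagonal support is contained in the parent pattern of a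
DAG compatible with the identity causal order, and whose diagonal entries are
nonzero, is invertible, and the off-diagonal support of its inverse is contained
in the ancestor pattern (the transitive closure of the parent relation). -/
theorem parent_support_inverse_ancestor_support
    {n : ℕ} (hn : 1 ≤ n) (pa : Fin n → Fin n → Prop)
    (hpa : ∀ i j : Fin n, pa j i → j < i)
    (L : Matrix (Fin n) (Fin n) ℝ)
    (hdiag : ∀ i, L i i ≠ 0)
    (hsupp : ∀ i j : Fin n, i ≠ j → ¬ pa j i → L i j = 0) :
    IsUnit L.det ∧ (∀ i, L⁻¹ i i ≠ 0) ∧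
      (∀ i j : Fin n, i ≠ j → ¬ Relation.TransGen pa j i → L⁻¹ i j = 0) := by
  exact ⟨isUnit_det_of_parent_support hpa hdiag hsupp,
    inv_apply_self_ne_zero_of_parent_support hpa hdiag hsupp,
    inv_apply_eq_zero_of_not_ancestor hpa hdiag hsupp⟩
end

section
/- Let n ≥ 1 and let pa be a relation on {1,…,n} (pa(j,i) meaning 'j is a parent of i') such that pa(j,i) implies j < i. For each i define Ch⁺(i) = {i} ∪ { c : pa(i,c) } (node i together with its children). Let L be an n×n real matrix with L_{ii} ≠ 0 for every i, and such that for all i ≠ j, L_{ij} ≠ 0 implies Ch⁺(i) ⊆ Ch⁺(j) (the support of L off the diagonal is contained in the surrounding pattern). Then L is invertible, (L⁻¹)_{ii} ≠ 0 for every i, and for all i ≠ j, (L⁻¹)_{ij} ≠ 0 implies Ch⁺(i) ⊆ Ch⁺(j). -/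
open Matrix

namespace Matrix

variable {ι K : Type*} [Fintype ι] [LinearOrder ι] [Field K] {A : Matrix ι ι K} {r : ι → ι → Prop}

/-- A matrix with nonzero diagonal, supported in a relation that refines `≥`, is invertible. -/
theorem isUnit_det_of_support (hdiag : ∀ i, A i i ≠ 0) (hr : ∀ i j, r i j → j ≤ i)
    (hA : ∀ i j, A i j ≠ 0 → r i j) : IsUnit A.det := by
  have hlower : A.BlockTriangular OrderDual.toDual := by
    intro i j hij
    by_contra h
    exact (hr i j (hA i j h)).not_gt hij
  rw [det_of_isLowerTriangular A hlower, isUnit_iff_ne_zero]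
  exact Finset.prod_ne_zero_iff.mpr fun i _ => hdiag i

/-- The support pattern of a preorder that refines `≥` is closed under matrix inversion. -/
theorem support_inv_of_support [IsPreorder ι r] (hdiag : ∀ i, A i i ≠ 0)
    (hr : ∀ i j, r i j → j ≤ i) (hA : ∀ i j, A i j ≠ 0 → r i j) (i j : ι)
    (hij : A⁻¹ i j ≠ 0) : r i j := by
  induction i using WellFoundedLT.induction with
  | ind i ih =>
    by_cases hne : i = j
    · exact hne ▸ refl_of r i
    have hsum : ∑ k, A i k * A⁻¹ k j = 0 := by
      rw [← mul_apply, mul_nonsing_inv A (isUnit_det_of_support hdiag hr hA), one_apply_ne hne]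
    obtain ⟨k, hk, hki⟩ : ∃ k, A i k * A⁻¹ k j ≠ 0 ∧ k ≠ i := by
      by_contra! h
      rw [Fintype.sum_eq_single i fun k hk => not_not.mp fun h0 => hk (h k h0)] at hsum
      exact mul_ne_zero (hdiag i) hij hsum
    have hik := hA i k (left_ne_zero_of_mul hk)
    exact trans_of r hik (ih k (lt_of_le_of_ne (hr i k hik) hki) (right_ne_zero_of_mul hk))

/-- Under the same support condition, the inverse has nonzero diagonal. -/
theorem inv_diag_ne_zero_of_support [IsPreorder ι r] (hdiag : ∀ i, A i i ≠ 0)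
    (hr : ∀ i j, r i j → j ≤ i) (hA : ∀ i j, A i j ≠ 0 → r i j) (i : ι) : A⁻¹ i i ≠ 0 := by
  have hsum : ∑ k, A i k * A⁻¹ k i = 1 := by
    rw [← mul_apply, mul_nonsing_inv A (isUnit_det_of_support hdiag hr hA), one_apply_eq]
  rw [Fintype.sum_eq_single i fun k hk => not_not.mp fun h0 => hk <| le_antisymm
    (hr i k (hA i k (left_ne_zero_of_mul h0)))
    (hr k i (support_inv_of_support hdiag hr hA k i (right_ne_zero_of_mul h0)))] at hsum
  exact right_ne_zero_of_mul_eq_one hsum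

end Matrix

/-- The surrounding sparsity pattern is closed under inversion: if `L` has
nonzero diagonal and `L i j ≠ 0` (for `i ≠ j`) implies `Ch⁺(i) ⊆ Ch⁺(j)`
(where `Ch⁺(i) = {i} ∪ {children of i}`), then `L` is invertible, `L⁻¹` has
nonzero diagonal, and `L⁻¹ i j ≠ 0` (for `i ≠ j`) implies `Ch⁺(i) ⊆ Ch⁺(j)`. -/
theorem surrounding_support_closed_under_inverse
    {n : ℕ} (hn : 1 ≤ n) (pa : Fin n → Fin n → Prop)
    (hpa : ∀ i j : Fin n, pa j i → j < i)
    (L : Matrix (Fin n) (Fin n) ℝ)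
    (hdiag : ∀ i, L i i ≠ 0)
    (hsupp : ∀ i j : Fin n, i ≠ j → L i j ≠ 0 →
      ({i} ∪ {c | pa i c} : Set (Fin n)) ⊆ ({j} ∪ {c | pa j c} : Set (Fin n))) :
    IsUnit L.det ∧ (∀ i, L⁻¹ i i ≠ 0) ∧
      (∀ i j : Fin n, i ≠ j → L⁻¹ i j ≠ 0 →
        ({i} ∪ {c | pa i c} : Set (Fin n)) ⊆ ({j} ∪ {c | pa j c} : Set (Fin n))) := by
  let ch : Fin n → Set (Fin n) := fun i => {i} ∪ {c | pa i c}
  let r : Fin n → Fin n → Prop := fun i j => ch i ⊆ ch j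
  have : IsPreorder (Fin n) r :=
    { refl := fun _ => subset_rfl
      trans := fun _ _ _ => Set.Subset.trans }
  have hr : ∀ i j, r i j → j ≤ i := by
    intro i j h
    rcases h (Or.inl rfl) with rfl | hji
    · exact le_rfl
    · exact (hpa i j hji).le
  have hL : ∀ i j, L i j ≠ 0 → r i j := by
    intro i j h
    by_cases hij : i = j
    · exact hij ▸ refl_of r i
    · exact hsupp i j hij h
  exact ⟨isUnit_det_of_support hdiag hr hL, inv_diag_ne_zero_of_support hdiag hr hL,
    fun i j _ => support_inv_of_support hdiag hr hL i j⟩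
end

section
/- Let P be a finite index set, k ∈ P, let σ, σ̄ > 0, and let w, w̄ ∈ ℝ^P. Define the linear forms L₁, L₂ : ℝ × ℝ^P → ℝ by L₁(t, z) = (1/σ² − 1/σ̄²)·t − Σ_{j∈P} (w_j/σ² − w̄_j/σ̄²)·z_j and L₂(t, z) = −(w_k/σ² − w̄_k/σ̄²)·t + Σ_{j∈P} (w_k·w_j/σ² − w̄_k·w̄_j/σ̄²)·z_j. Then there exists a constant κ ∈ ℝ with κ·L₁(t,z) = L₂(t,z) for all (t,z) ∈ ℝ × ℝ^P if and only if w_k = w̄_k. -/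
/-- Linear Gaussian example for Assumption 1: the two coordinates `L₁, L₂` of the
latent score difference of a soft intervention on a linear Gaussian mechanism are
proportional (as linear forms on `ℝ × ℝ^P`) iff the weight of parent `k` is
unchanged by the intervention, i.e. `w k = w̄ k`. -/
theorem linear_gaussian_proportionality_iff_weight_unchanged
    {P : Type*} [Fintype P] (k : P) (σ σbar : ℝ) (hσ : 0 < σ) (hσbar : 0 < σbar)
    (w wbar : P → ℝ)
    (L₁ L₂ : ℝ → (P → ℝ) → ℝ)
    (hL₁ : ∀ t z, L₁ t z = (1 / σ ^ 2 - 1 / σbar ^ 2) * t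
        - ∑ j, (w j / σ ^ 2 - wbar j / σbar ^ 2) * z j)
    (hL₂ : ∀ t z, L₂ t z = -(w k / σ ^ 2 - wbar k / σbar ^ 2) * t
        + ∑ j, (w k * w j / σ ^ 2 - wbar k * wbar j / σbar ^ 2) * z j) :
    (∃ κ : ℝ, ∀ (t : ℝ) (z : P → ℝ), κ * L₁ t z = L₂ t z) ↔ w k = wbar k := by
  classical
  constructor
  · rintro ⟨κ, h⟩
    have h₁ := h 1 0
    have h₂ := h 0 (Pi.single k 1)
    simp only [hL₁, hL₂, Pi.zero_apply, mul_zero, Finset.sum_const_zero, Pi.single_apply,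
      mul_ite, mul_one, Finset.sum_ite_eq', Finset.mem_univ, if_true, sub_zero, zero_sub,
      add_zero, zero_add] at h₁ h₂
    have hab : 1 / σ ^ 2 * (1 / σbar ^ 2) ≠ 0 := by positivity
    have hdet : 1 / σ ^ 2 * (1 / σbar ^ 2) * (w k - wbar k) ^ 2 = 0 := by
      linear_combination (w k / σ ^ 2 - wbar k / σbar ^ 2) * h₁
        + (1 / σ ^ 2 - 1 / σbar ^ 2) * h₂
    have hsq := (mul_eq_zero.mp hdet).resolve_left hab
    exact sub_eq_zero.mp (pow_eq_zero_iff two_ne_zero |>.mp hsq)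
  · intro hk
    refine ⟨-w k, fun t z => ?_⟩
    have hsum : ∑ j, (w k * w j / σ ^ 2 - w k * wbar j / σbar ^ 2) * z j
        = w k * ∑ j, (w j / σ ^ 2 - wbar j / σbar ^ 2) * z j := by
      rw [Finset.mul_sum]
      exact Finset.sum_congr rfl fun j _ => by ring
    rw [hL₁, hL₂, ← hk, hsum]
    ring
end
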